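/- arXiv:1407.0648 — 4 statements merged into one kernel-verified Lean document; each statement's English description precedes it below -/
import Mathlib

section
/- Let l be an even positive integer, r a positive integer, q an integer with q > 2r, ζ ∈ {1, −1}, p = l·q + ζ·r, and let N be a positive real number. Let α ∈ {0, 1} with (1−α)·ζ·r + q − 1 even, and let a, m be integers with 0 < a < p/2, 0 ≤ m ≤ l/2, |a − m·p/l| < N·√p, and 0 ≤ a + ((1−α)·ζ·r + q − 1)/2 − m·q < q. Let k be an integer with 0 ≤ k < (p − (2l+1)·r + l)/(2N·l²·√p) − 1/l, and set i_k = ((1−α)·p + q − 1)/2 + k·(a·l − m·p) and j_k = ((1−α)·ζ·r + q − 1)/2 + k·(a·l − m·p). Then 0 ≤ i_k < p + q, 0 ≤ i_k + a < p + q, 0 ≤ j_k < q, and 0 ≤ j_k + a − m·q < q. -/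
/-- If `|a - m p / l| < N √p` and `k + 1 / l` is less than `c / (2 N l² √p)`, then
`2 (k l + 1) |a l - m p| < c`. -/
theorem two_mul_mul_abs_lt_of_lt_div (l p a m k c : ℤ) (N : ℝ) (hl : 0 < l) (hN : 0 < N)
    (hp : 0 < p) (hk₀ : 0 ≤ k) (haN : |(a : ℝ) - m * p / l| < N * Real.sqrt p)
    (hk₁ : (k : ℝ) < (c : ℝ) / (2 * N * l ^ 2 * Real.sqrt p) - 1 / l) :
    2 * (k * l + 1) * |a * l - m * p| < c := by
  have hl' : (0 : ℝ) < l := by exact_mod_cast hl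
  have hk' : (0 : ℝ) ≤ k := by exact_mod_cast hk₀
  have hs : 0 < Real.sqrt p := Real.sqrt_pos.mpr (by exact_mod_cast hp)
  have hD : |(a : ℝ) * l - m * p| < l * (N * Real.sqrt p) := by
    have h : (a : ℝ) * l - m * p = l * (a - m * p / l) := by field_simp
    rw [h, abs_mul, abs_of_pos hl']
    exact mul_lt_mul_of_pos_left haN hl'
  have hc : ((k : ℝ) + 1 / l) * (2 * N * l ^ 2 * Real.sqrt p) < c :=
    (lt_div_iff₀ (by positivity)).mp (by linarith)
  have hkl : ((k : ℝ) + 1 / l) * (2 * N * l ^ 2 * Real.sqrt p)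
      = 2 * (k * l + 1) * (l * (N * Real.sqrt p)) := by field_simp
  have h := mul_lt_mul_of_pos_left hD (show (0 : ℝ) < 2 * (k * l + 1) by positivity)
  have hfin : 2 * ((k : ℝ) * l + 1) * |(a : ℝ) * l - m * p| < c := by linarith
  exact_mod_cast hfin


/-- The inequalities (eq:ikjk) in the proof of Lemma 3.3: for `k` in the range
(eq:kRange), the Spin^c indices `i_k` and `j_k` satisfy `0 ≤ i_k, i_k + a < p + q`
and `0 ≤ j_k, j_k + a - mq < q`. -/
theorem ik_jk_bounds (l r q ζ p α a m k : ℤ) (N : ℝ) (hl : 0 < l) (hleven : Even l)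
    (hr : 0 < r) (hq : 2 * r < q) (hζ : ζ = 1 ∨ ζ = -1) (hp : p = l * q + ζ * r)
    (hN : 0 < N) (hα : α = 0 ∨ α = 1) (hpar : Even ((1 - α) * ζ * r + q - 1))
    (ha₀ : 0 < a) (ha₁ : 2 * a < p) (hm₀ : 0 ≤ m) (hm₁ : 2 * m ≤ l)
    (haN : |(a : ℝ) - m * p / l| < N * Real.sqrt p)
    (hmq₀ : 0 ≤ a + ((1 - α) * ζ * r + q - 1) / 2 - m * q)
    (hmq₁ : a + ((1 - α) * ζ * r + q - 1) / 2 - m * q < q)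
    (hk₀ : 0 ≤ k)
    (hk₁ : (k : ℝ) < ((p : ℝ) - (2 * l + 1) * r + l) / (2 * N * l ^ 2 * Real.sqrt p) - 1 / l)
    (ik jk : ℤ)
    (hik : ik = ((1 - α) * p + q - 1) / 2 + k * (a * l - m * p))
    (hjk : jk = ((1 - α) * ζ * r + q - 1) / 2 + k * (a * l - m * p)) :
    (0 ≤ ik ∧ ik < p + q) ∧ (0 ≤ ik + a ∧ ik + a < p + q) ∧
      (0 ≤ jk ∧ jk < q) ∧ (0 ≤ jk + a - m * q ∧ jk + a - m * q < q) := by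
  have key := two_mul_mul_abs_lt_of_lt_div l p a m k (p - (2 * l + 1) * r + l) N hl hN
    (by linarith) hk₀ haN (by push_cast; exact hk₁)
  have hpar' : Even ((1 - α) * p + q - 1) := by
    have h : (1 - α) * p + q - 1 = ((1 - α) * ζ * r + q - 1) + l * ((1 - α) * q) := by
      rw [hp]; ring
    rw [h]
    exact hpar.add (hleven.mul_right _)
  have hi : 2 * ik = (1 - α) * p + q - 1 + 2 * (k * (a * l - m * p)) := by
    rw [hik, mul_add, Int.two_mul_ediv_two_of_even hpar']
  have hj : 2 * jk = (1 - α) * ζ * r + q - 1 + 2 * (k * (a * l - m * p)) := by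
    rw [hjk, mul_add, Int.two_mul_ediv_two_of_even hpar]
  have hal : l * (a - m * q) = (a * l - m * p) + m * r * ζ := by rw [hp]; ring
  generalize a * l - m * p = D at *
  have hζr : ζ * r ≤ r := by rcases hζ with rfl | rfl <;> linarith
  have hkD : 2 * |k * D| < q - 2 * r + 1 := by
    rw [abs_mul, abs_of_nonneg hk₀]
    refine lt_of_mul_lt_mul_left ?_ hl.le
    linarith [abs_nonneg D]
  obtain ⟨hkD₁, hkD₂⟩ := abs_le.mp (le_refl |k * D|)
  have key₂ : |2 * (k * l + 1) * D| < p - (2 * l + 1) * r + l := by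
    rwa [abs_mul, abs_of_pos (show 0 < 2 * (k * l + 1) by positivity)]
  obtain ⟨h₁, h₂⟩ := abs_lt.mp key₂
  have hmr : 2 * (m * r) ≤ l * r := by nlinarith
  have hmr₀ : 0 ≤ m * r := by positivity
  have hlr : 0 < l * r := by positivity
  have hJ : 2 * (l * (jk + a - m * q))
      = l * ((1 - α) * ζ * r + q - 1) + 2 * (k * l + 1) * D + 2 * (m * r * ζ) := by
    linear_combination l * hj + 2 * hal
  have hJ₀ : -1 < jk + a - m * q := by
    refine lt_of_mul_lt_mul_left ?_ hl.le
    rcases hζ with rfl | rfl <;> rcases hα with rfl | rfl <;> linarith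
  have hJ₁ : jk + a - m * q < q := by
    refine lt_of_mul_lt_mul_left ?_ hl.le
    rcases hζ with rfl | rfl <;> rcases hα with rfl | rfl <;> linarith
  refine ⟨?_, ?_, ?_, by omega, hJ₁⟩ <;>
    rcases hζ with rfl | rfl <;> rcases hα with rfl | rfl <;> constructor <;> omega
end

section
/- Let l be an even positive integer, let r, q be integers with 0 < r < q and gcd(q, r) = 1, and set p = l·q + r. Let a, m, k, α be integers with k ≥ 0 and α ∈ {0, 1}, and suppose (1−α)·p + q − 1 is even. Set i_k = ((1−α)·p + q − 1)/2 + k·(a·l − m·p) and j_k = ((1−α)·r + q − 1)/2 + k·(a·l − m·p). Assume 0 ≤ i_k < p + q, 0 ≤ i_k + a < p + q, 0 ≤ j_k < q, and 0 ≤ j_k + a − m·q < q. Then d(p, q, i_k + a) − d(p, q, i_k) = −(2·(a·l − m·p)²/(p·r))·k − (l/(p·r))·(a − m·p/l)² + m²/l − m·α + d(r, q mod r, j_k + a − m·q) − d(r, q mod r, j_k). -/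
/-- The Ozsváth–Szabó correction term `d(L(p,q), i)` of the lens space `L(p,q)`,
defined for `p > q ≥ 0` coprime by the recursion `d(1,0,i) = 0` and
`d(p,q,i) = -1/4 + (2 i₀ + 1 - p - q)²/(4pq) - d(q, p mod q, i₀)` where
`i₀ = i mod p`. -/
def dCorr : ℕ → ℕ → ℤ → ℚ
  | _, 0, _ => 0
  | p, q + 1, i =>
    -1/4 + (2 * ((i % (p : ℤ) : ℤ) : ℚ) + 1 - (p : ℚ) - ((q + 1 : ℕ) : ℚ)) ^ 2
        / (4 * (p : ℚ) * ((q + 1 : ℕ) : ℚ))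
      - dCorr (q + 1) (p % (q + 1)) (i % (p : ℤ))
  termination_by p q _ => q
  decreasing_by exact Nat.lt_succ_of_le (Nat.le_of_lt_succ (Nat.mod_lt _ (Nat.succ_pos q)))

theorem dCorr_of_pos {p q : ℕ} (hq : 0 < q) (i : ℤ) :
    dCorr p q i = -1 / 4 + (2 * ((i % (p : ℤ) : ℤ) : ℚ) + 1 - p - q) ^ 2 / (4 * p * q)
      - dCorr q (p % q) (i % (p : ℤ)) := by
  obtain ⟨q, rfl⟩ := Nat.exists_eq_succ_of_ne_zero hq.ne'
  rw [dCorr]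

theorem dCorr_emod (p q : ℕ) (i : ℤ) : dCorr p q (i % (p : ℤ)) = dCorr p q i := by
  cases q with
  | zero => simp [dCorr]
  | succ q => simp [dCorr]

theorem dCorr_congr (p q : ℕ) {i j : ℤ} (h : i ≡ j [ZMOD p]) : dCorr p q i = dCorr p q j := by
  rw [← dCorr_emod, h, dCorr_emod]

/-- The recursion for `dCorr` holds without reducing `i` modulo `p` on the whole range
`0 ≤ i < p + q`. -/
theorem dCorr_of_lt_add {p q : ℕ} (hq : 0 < q) (hqp : q < p) (hpq : Nat.Coprime p q) {i : ℤ}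
    (hi : 0 ≤ i) (hi' : i < p + q) :
    dCorr p q i = -1 / 4 + (2 * (i : ℚ) + 1 - p - q) ^ 2 / (4 * p * q)
      - dCorr q (p % q) i := by
  induction q using Nat.strong_induction_on generalizing p i with
  | _ q ih =>
  rw [dCorr_of_pos hq]
  rcases lt_or_ge i p with h | h
  · rw [Int.emod_eq_of_lt hi h]
  obtain ⟨j, rfl⟩ : ∃ j, i = j + p := ⟨i - p, by ring⟩
  have hj : 0 ≤ j := by omega
  have hjq : j < q := by omega
  rw [Int.add_emod_right, Int.emod_eq_of_lt hj (by omega)]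
  have hp0 : (p : ℚ) ≠ 0 := by exact_mod_cast (by omega : p ≠ 0)
  have hq0 : (q : ℚ) ≠ 0 := by exact_mod_cast hq.ne'
  have hshift : dCorr q (p % q) (j + p) - dCorr q (p % q) j = (2 * (j : ℚ) + 1 - q) / q := by
    rw [dCorr_congr q (p % q) (show j + p ≡ j + (p % q : ℕ) [ZMOD q] by
      simpa using (Int.mod_modEq (p : ℤ) q).symm.add_left j)]
    have hcop : Nat.Coprime q (p % q) := by
      rwa [Nat.coprime_comm, Nat.Coprime, ← Nat.gcd_rec, Nat.gcd_comm]
    have hlt : p % q < q := Nat.mod_lt _ hq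
    generalize p % q = r at hcop hlt ⊢
    rcases Nat.eq_zero_or_pos r with rfl | hr
    · obtain rfl : q = 1 := by simpa using hcop
      obtain rfl : j = 0 := by omega
      simp
    · have hr0 : (r : ℚ) ≠ 0 := by exact_mod_cast hr.ne'
      rw [ih r hlt hr hlt hcop (by omega) (by omega), ih r hlt hr hlt hcop hj (by omega),
        dCorr_congr r (q % r) (show j + r ≡ j [ZMOD r] by simp)]
      push_cast
      field_simp
      ring
  rw [sub_eq_iff_eq_add.mp hshift]
  push_cast
  field_simp
  ring

/-- The `ζ = +1` telescoped correction-term computation in the proof of Lemma 3.3: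
with `p = lq + r`,
`d(p,q,i_k+a) - d(p,q,i_k) = -(2(al-mp)²/(pr))k - (l/(pr))(a - mp/l)² + m²/l - mα
  + d(r, q mod r, j_k + a - mq) - d(r, q mod r, j_k)`. -/
theorem dCorr_telescoped_plus (l r q : ℕ) (hl : 0 < l) (hleven : Even l)
    (hr : 0 < r) (hrq : r < q) (hgcd : Nat.Coprime q r) (p : ℕ) (hp : p = l * q + r)
    (a m k α : ℤ) (hk : 0 ≤ k) (hα : α = 0 ∨ α = 1)
    (hpar : Even ((1 - α) * (p : ℤ) + (q : ℤ) - 1))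
    (ik jk : ℤ)
    (hik : ik = ((1 - α) * (p : ℤ) + (q : ℤ) - 1) / 2 + k * (a * l - m * p))
    (hjk : jk = ((1 - α) * (r : ℤ) + (q : ℤ) - 1) / 2 + k * (a * l - m * p))
    (h1 : 0 ≤ ik) (h2 : ik < (p : ℤ) + q) (h3 : 0 ≤ ik + a) (h4 : ik + a < (p : ℤ) + q)
    (h5 : 0 ≤ jk) (h6 : jk < (q : ℤ))
    (h7 : 0 ≤ jk + a - m * q) (h8 : jk + a - m * q < (q : ℤ)) :
    dCorr p q (ik + a) - dCorr p q ik =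
      -(2 * ((a : ℚ) * l - m * p) ^ 2 / (p * r)) * k
        - ((l : ℚ) / (p * r)) * ((a : ℚ) - m * p / l) ^ 2
        + (m : ℚ) ^ 2 / l - (m : ℚ) * α
        + dCorr r (q % r) (jk + a - m * q) - dCorr r (q % r) jk := by
  obtain ⟨c, rfl⟩ := hleven
  have hmod : p % q = r := by rw [hp, Nat.mul_add_mod', Nat.mod_eq_of_lt hrq]
  have hqp : q < p := by nlinarith
  have hpq : Nat.Coprime p q := by
    rw [hp, Nat.coprime_comm]
    simpa using hgcd
  have hpZ : (p : ℤ) = 2 * (c * q) + r := by rw [hp]; push_cast; ring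
  have hij : ik = jk + (1 - α) * (c * q) := by
    rw [hik, hjk]
    rcases hα with rfl | rfl
    · omega
    · simp
  have hj2 : 2 * jk + 1 - q - r = -α * r + 2 * (k * (a * (c + c : ℕ) - m * p)) := by
    rcases hα with rfl | rfl
    · rw [hpZ] at hpar
      obtain ⟨t, ht⟩ := hpar
      omega
    · obtain ⟨t, ht⟩ := hpar
      omega
  have hcong : ik ≡ jk [ZMOD q] := by
    rw [hij, ← mul_assoc]
    simp
  have hcong' : ik + a ≡ jk + a - m * q [ZMOD q] := by
    refine (hcong.add_right a).trans ?_
    simp [Int.modEq_iff_dvd]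
  have hp0 : (p : ℚ) ≠ 0 := by exact_mod_cast (by omega : p ≠ 0)
  have hq0 : (q : ℚ) ≠ 0 := by exact_mod_cast (by omega : q ≠ 0)
  have hr0 : (r : ℚ) ≠ 0 := by exact_mod_cast hr.ne'
  have hc0 : (c : ℚ) ≠ 0 := by exact_mod_cast (by omega : c ≠ 0)
  rw [dCorr_of_lt_add (by omega) hqp hpq h3 h4, dCorr_of_lt_add (by omega) hqp hpq h1 h2, hmod,
    dCorr_congr q r hcong, dCorr_congr q r hcong', dCorr_of_lt_add hr hrq hgcd h5 (by omega),
    dCorr_of_lt_add hr hrq hgcd h7 (by omega)]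
  have hpQ : (p : ℚ) = 2 * (c * q) + r := by exact_mod_cast hpZ
  have hijQ : (ik : ℚ) = jk + (1 - α) * (c * q) := by exact_mod_cast hij
  have hjQ : (jk : ℚ) = (-α * r + 2 * (k * (a * (2 * c) - m * p)) - 1 + q + r) / 2 := by
    have h : (2 * jk + 1 - q - r : ℚ) = -α * r + 2 * (k * (a * (c + c) - m * p)) := by
      exact_mod_cast hj2
    linear_combination h / 2
  push_cast
  rw [hijQ, hjQ]
  rw [hpQ] at hp0 ⊢
  have hcc : (c : ℚ) + c = 2 * c := by ring
  rw [hcc]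
  field_simp
  ring
end

section
/- Let q be a positive integer coprime to 6 (so q is odd and q mod 6 ∈ {1, 5}). Then for every m ∈ {0, 1, 2, 3}, every α ∈ {0, 1}, and all ε, ζ, σ ∈ {1, −1}, the rational number −ε·m²/6 + d(6, q mod 6, ζ·m + σ + 3·ζ·(1−α) + (q−1)/2) − d(6, q mod 6, 3·ζ·(1−α) + (q−1)/2) is not an integer. -/
theorem dCorr_six_one (i : ℤ) : dCorr 6 1 i = -1 / 4 + ((i % 6 - 3 : ℤ) : ℚ) ^ 2 / 6 := by
  rw [dCorr, dCorr]
  push_cast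
  ring

theorem dCorr_six_five (i : ℤ) :
    dCorr 6 5 i = 1 / 4 - (((i + 1) % 6 - 3 : ℤ) : ℚ) ^ 2 / 6 := by
  have h : dCorr 6 5 i = dCorr 6 5 (i % 6) := by simp [dCorr]
  have hr : i % 6 = 0 ∨ i % 6 = 1 ∨ i % 6 = 2 ∨ i % 6 = 3 ∨ i % 6 = 4 ∨ i % 6 = 5 := by omega
  rw [h, ← Int.emod_add_emod]
  rcases hr with hr | hr | hr | hr | hr | hr <;> rw [hr, dCorr, dCorr, dCorr] <;> norm_num

theorem Int.sq_emod_two (x : ℤ) : x ^ 2 % 2 = x % 2 := by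
  rcases Int.emod_two_eq_zero_or_one x with h | h <;> simp [pow_two, Int.mul_emod, h]

/-- Expression (16) of the paper is never an integer: for `q` coprime to 6,
`-ε m²/6 + d(6, q mod 6, ζm ± 1 + 3ζ(1-α) + (q-1)/2) - d(6, q mod 6, 3ζ(1-α) + (q-1)/2)`
is not an integer for any `m ∈ {0,1,2,3}`, `α ∈ {0,1}`, `ε, ζ, σ ∈ {±1}`. -/
theorem expr16_not_integer (q : ℕ) (hq : 0 < q) (hcop : Nat.Coprime q 6)
    (m α ε ζ σ : ℤ) (hm : m = 0 ∨ m = 1 ∨ m = 2 ∨ m = 3) (hα : α = 0 ∨ α = 1)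
    (hε : ε = 1 ∨ ε = -1) (hζ : ζ = 1 ∨ ζ = -1) (hσ : σ = 1 ∨ σ = -1) :
    ¬ ∃ n : ℤ,
      -(ε : ℚ) * (m : ℚ) ^ 2 / 6
          + dCorr 6 (q % 6) (ζ * m + σ + 3 * ζ * (1 - α) + ((q : ℤ) - 1) / 2)
          - dCorr 6 (q % 6) (3 * ζ * (1 - α) + ((q : ℤ) - 1) / 2) = (n : ℚ) := by
  rintro ⟨n, h⟩
  have hq6 : q % 6 = 1 ∨ q % 6 = 5 := by
    have h2 : ¬ 2 ∣ q := fun hd => by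
      have := Nat.dvd_gcd hd (by norm_num : 2 ∣ 6)
      rw [hcop] at this
      omega
    have h3 : ¬ 3 ∣ q := fun hd => by
      have := Nat.dvd_gcd hd (by norm_num : 3 ∣ 6)
      rw [hcop] at this
      omega
    omega
  generalize 3 * ζ * (1 - α) = b at h
  rw [add_assoc _ b] at h
  generalize b + ((q : ℤ) - 1) / 2 = c at h
  have key : ∀ s A B : ℤ, s = 1 ∨ s = -1 → (A - B - (m + 1)) % 2 = 0 →
      -ε * m ^ 2 + s * (A ^ 2 - B ^ 2) ≠ 6 * n := by
    intro s A B hs hAB he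
    have hA := Int.sq_emod_two A
    have hB := Int.sq_emod_two B
    have hM := Int.sq_emod_two m
    rcases hs with rfl | rfl <;> rcases hε with rfl | rfl <;> omega
  have hpar : (ζ * m + σ - (m + 1)) % 2 = 0 := by
    rcases hζ with rfl | rfl <;> rcases hσ with rfl | rfl <;> omega
  generalize ζ * m + σ = k at h hpar
  rcases hq6 with hq6 | hq6
  · rw [hq6, dCorr_six_one, dCorr_six_one] at h
    refine key 1 ((k + c) % 6 - 3) (c % 6 - 3) (Or.inl rfl) (by omega) ?_
    qify at h ⊢
    linarith
  · rw [hq6, dCorr_six_five, dCorr_six_five] at h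
    refine key (-1) ((k + c + 1) % 6 - 3) ((c + 1) % 6 - 3) (Or.inr rfl) (by omega) ?_
    qify at h ⊢
    linarith
end

section
/- Let s, t, q be integers with t ≥ 2 and q ≥ 1, and let ε₁, ε₂ ∈ {1, −1}. If s·t·q + ε₁ = 6·t²·q + 6·ε₂, then q = 1 and (s, t) is one of (29, 5), (31, 5), (41, 7), (43, 7); correspondingly s·t·q + ε₁ equals 144, 156, 288, or 300 respectively. -/
/-- The Diophantine core of Proposition 4.2: if `stq + ε₁ = 6t²q + 6ε₂` with `t ≥ 2`,
`q ≥ 1` and `ε₁, ε₂ ∈ {±1}`, then `q = 1` and `(s,t)` is one of `(29,5)`, `(31,5)`,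
`(41,7)`, `(43,7)`, with `stq + ε₁` equal to `144`, `156`, `288`, `300` respectively. -/
theorem cable_slope_classification (s t q ε₁ ε₂ : ℤ) (ht : 2 ≤ t) (hq : 1 ≤ q)
    (hε₁ : ε₁ = 1 ∨ ε₁ = -1) (hε₂ : ε₂ = 1 ∨ ε₂ = -1)
    (h : s * t * q + ε₁ = 6 * t ^ 2 * q + 6 * ε₂) :
    q = 1 ∧
      ((s = 29 ∧ t = 5 ∧ s * t * q + ε₁ = 144) ∨
       (s = 31 ∧ t = 5 ∧ s * t * q + ε₁ = 156) ∨
       (s = 41 ∧ t = 7 ∧ s * t * q + ε₁ = 288) ∨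
       (s = 43 ∧ t = 7 ∧ s * t * q + ε₁ = 300)) := by
  have key : t * q * (s - 6 * t) = 6 * ε₂ - ε₁ := by linear_combination h
  have hdvd : t * q ∣ 6 * ε₂ - ε₁ := ⟨_, key.symm⟩
  have hle : t * q ≤ 7 := by
    rcases hε₁ with rfl | rfl <;> rcases hε₂ with rfl | rfl
    · linarith [Int.le_of_dvd (by norm_num) hdvd]
    · linarith [Int.le_of_dvd (by norm_num) ((dvd_neg).mpr hdvd)]
    · linarith [Int.le_of_dvd (by norm_num) hdvd]
    · linarith [Int.le_of_dvd (by norm_num) ((dvd_neg).mpr hdvd)]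
  have ht7 : t ≤ 7 := by nlinarith
  have hq3 : q ≤ 3 := by nlinarith
  have htq : q = 1 ∧ (t = 5 ∨ t = 7) := by
    clear h hle key
    interval_cases q <;> interval_cases t <;> omega
  obtain ⟨rfl, rfl | rfl⟩ := htq <;> omega
end
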